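/- Fix an integer n ≥ 1 and let X be an element of the class C_n of all finite n-colorable graphs. Then for every Y ∈ C_n and every k ∈ ℕ there exists Z ∈ C_n such that for every map α from the copies of X in Z to {1,…,k} there is a copy Ỹ of Y in Z such that α takes at most τ(X) values on the copies of X in Ỹ, where τ(X) is the number of non-isomorphic extensions of X in M^<_n. -/

import Mathlib

/-- `f` is an embedding of ordered graphs (vertex sets `Fin a`, `Fin c` with their
natural linear orders): strictly increasing, preserving and reflecting adjacency. -/
def OrdEmb {a c : ℕ} (X : SimpleGraph (Fin a)) (Z : SimpleGraph (Fin c))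
    (f : Fin a → Fin c) : Prop :=
  StrictMono f ∧ ∀ i j, Z.Adj (f i) (f j) ↔ X.Adj i j

/-- `lam` is a proper coloring of `X` with colors in `Fin n`. -/
def ProperCol {a n : ℕ} (X : SimpleGraph (Fin a)) (lam : Fin a → Fin n) : Prop :=
  ∀ i j, X.Adj i j → lam i ≠ lam j

/-- `f` is an embedding of ordered `[n]`-colored graphs: an ordered-graph embedding
that also preserves the vertex colorings. -/
def ColOrdEmb {n a c : ℕ} (X : SimpleGraph (Fin a)) (lamX : Fin a → Fin n)
    (Z : SimpleGraph (Fin c)) (lamZ : Fin c → Fin n) (f : Fin a → Fin c) : Prop :=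
  OrdEmb X Z f ∧ ∀ i, lamZ (f i) = lamX i

/-- `S` is the vertex set of an induced copy of the (unordered) graph `X` in `Z`. -/
def IsCopy {a c : ℕ} (X : SimpleGraph (Fin a)) (Z : SimpleGraph (Fin c))
    (S : Finset (Fin c)) : Prop :=
  ∃ f : Fin a → Fin c, Function.Injective f ∧
    (∀ i j, Z.Adj (f i) (f j) ↔ X.Adj i j) ∧ Finset.image f Finset.univ = S

/-- `τ(X)`: the number of non-isomorphic extensions of the (unordered) graph `X`
in `M^<_n`, i.e. the number of structures on `Fin a` (with its natural order)
whose graph is isomorphic to `X`, equipped with a monotone proper `[n]`-coloring. -/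
noncomputable def TauNum (n : ℕ) {a : ℕ} (X : SimpleGraph (Fin a)) : ℕ :=
  Nat.card {p : SimpleGraph (Fin a) × (Fin a → Fin n) //
    Nonempty (p.1 ≃g X) ∧ ProperCol p.1 p.2 ∧ Monotone p.2}

/-- A finite graph whose vertices are sorted into parts indexed by `K`. -/
structure PartiteSystem (K : Type) where
  V : Type
  finite : Finite V
  graph : SimpleGraph V
  key : V → K

namespace PartiteSystem

variable {K : Type} {P Q R : PartiteSystem K} {a : ℕ}

/-- Induced embeddings of partite systems that preserve the parts. -/
structure IsEmb (P Q : PartiteSystem K) (f : P.V → Q.V) : Prop where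
  injective : Function.Injective f
  adj_iff : ∀ x y, Q.graph.Adj (f x) (f y) ↔ P.graph.Adj x y
  key_eq : ∀ x, Q.key (f x) = P.key x

/-- `e` is an induced copy of `H` in `P` whose `t`-th vertex lies in the part `p t`. -/
structure IsCopyOver (P : PartiteSystem K) (H : SimpleGraph (Fin a)) (p : Fin a → K)
    (e : Fin a → P.V) : Prop where
  adj_iff : ∀ s t, P.graph.Adj (e s) (e t) ↔ H.Adj s t
  key_eq : ∀ t, P.key (e t) = p t

/-- Adjacent vertices lie in parts with distinct labels. -/
def IsProper {L : Type} (P : PartiteSystem K) (r : K → L) : Prop :=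
  ∀ x y, P.graph.Adj x y → r (P.key x) ≠ r (P.key y)

theorem IsEmb.refl (P : PartiteSystem K) : IsEmb P P id :=
  ⟨Function.injective_id, fun _ _ => Iff.rfl, fun _ => rfl⟩

theorem IsEmb.comp {g : Q.V → R.V} {f : P.V → Q.V} (hg : IsEmb Q R g) (hf : IsEmb P Q f) :
    IsEmb P R (g ∘ f) :=
  ⟨hg.injective.comp hf.injective, fun x y => (hg.adj_iff _ _).trans (hf.adj_iff x y),
    fun x => (hg.key_eq _).trans (hf.key_eq x)⟩

theorem IsEmb.isCopyOver {f : P.V → Q.V} (hf : IsEmb P Q f) {H : SimpleGraph (Fin a)}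
    {p : Fin a → K} {e : Fin a → P.V} (he : P.IsCopyOver H p e) : Q.IsCopyOver H p (f ∘ e) :=
  ⟨fun s t => (hf.adj_iff _ _).trans (he.adj_iff s t),
    fun t => (hf.key_eq _).trans (he.key_eq t)⟩

section Lines

open Combinatorics

variable (P) (H : SimpleGraph (Fin a)) (p : Fin a → K) {M : Type}

/-- The vertices of the amalgam of the copies of `P` indexed by combinatorial lines over the
alphabet of copies of `H`: vertices outside the parts `p t` remember their line. -/
abbrev LineVertex (M : Type) : Type :=
  (M → P.V) × K × Option (M → Option {e : Fin a → P.V // P.IsCopyOver H p e})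

open Classical in
/-- The copy of `P` along a combinatorial line of copies of `H`. -/
noncomputable def lineMap (l : Line {e : Fin a → P.V // P.IsCopyOver H p e} M) (x : P.V) :
    LineVertex P H p M :=
  (fun m => (l.idxFun m).elim x fun e => Function.extend p e.1 (fun _ => x) (P.key x),
    P.key x, if P.key x ∈ Set.range p then none else some l.idxFun)

variable {P H p}

theorem lineMap_injective (l : Line {e : Fin a → P.V // P.IsCopyOver H p e} M) :
    Function.Injective (lineMap P H p l) := by
  intro x y h
  obtain ⟨m, hm⟩ := l.proper
  have := congrFun (congrArg Prod.fst h) m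
  simpa [lineMap, hm] using this

theorem lineMap_idxFun_eq {l l' : Line {e : Fin a → P.V // P.IsCopyOver H p e} M} {x x' : P.V}
    (h : lineMap P H p l x = lineMap P H p l' x') (hx : P.key x ∉ Set.range p) : l = l' := by
  have h2 : P.key x = P.key x' := congrArg (fun v => v.2.1) h
  have h3 := congrArg (fun v => v.2.2) h
  have hx' := hx
  rw [h2] at hx'
  simp only [lineMap, if_neg hx, if_neg hx', Option.some.injEq] at h3
  exact Line.ext h3

theorem lineMap_fst_of_some (hp : Function.Injective p)
    {l : Line {e : Fin a → P.V // P.IsCopyOver H p e} M} {x : P.V} {t : Fin a}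
    (hx : P.key x = p t) {m : M} {e : {e : Fin a → P.V // P.IsCopyOver H p e}}
    (hm : l.idxFun m = some e) : (lineMap P H p l x).1 m = e.1 t := by
  simp [lineMap, hm, hx, hp.extend_apply]

theorem lineMap_fst_of_none {l : Line {e : Fin a → P.V // P.IsCopyOver H p e} M} {x : P.V}
    {m : M} (hm : l.idxFun m = none) : (lineMap P H p l x).1 m = x := by
  simp [lineMap, hm]

theorem adj_of_lineMap_eq (hp : Function.Injective p)
    {l l' : Line {e : Fin a → P.V // P.IsCopyOver H p e} M} {x y x' y' : P.V}
    (hx : lineMap P H p l x = lineMap P H p l' x') (hy : lineMap P H p l y = lineMap P H p l' y')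
    (h : P.graph.Adj x' y') : P.graph.Adj x y := by
  have of_eq : l = l' → P.graph.Adj x y := by
    rintro rfl
    rwa [lineMap_injective l hx, lineMap_injective l hy]
  by_cases hs : P.key x ∈ Set.range p
  swap
  · exact of_eq (lineMap_idxFun_eq hx hs)
  by_cases ht : P.key y ∈ Set.range p
  swap
  · exact of_eq (lineMap_idxFun_eq hy ht)
  obtain ⟨s, hs⟩ := hs
  obtain ⟨t, ht⟩ := ht
  have hs' : P.key x' = p s := hs ▸ (congrArg (fun v => v.2.1) hx).symm
  have ht' : P.key y' = p t := ht ▸ (congrArg (fun v => v.2.1) hy).symm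
  have hx1 := fun m => congrFun (congrArg Prod.fst hx) m
  have hy1 := fun m => congrFun (congrArg Prod.fst hy) m
  obtain ⟨m, hm⟩ := l.proper
  obtain ⟨m', hm'⟩ := l'.proper
  have hxm' := hx1 m'
  have hym' := hy1 m'
  rw [lineMap_fst_of_none hm'] at hxm' hym'
  cases hlm' : l.idxFun m' with
  | none =>
    rw [lineMap_fst_of_none hlm'] at hxm' hym'
    rwa [hxm', hym']
  | some e =>
    rw [lineMap_fst_of_some hp hs.symm hlm'] at hxm'
    rw [lineMap_fst_of_some hp ht.symm hlm'] at hym'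
    have hst : H.Adj s t := by
      rwa [← e.2.adj_iff, hxm', hym']
    have hxm := hx1 m
    have hym := hy1 m
    rw [lineMap_fst_of_none hm] at hxm hym
    cases hlm : l'.idxFun m with
    | none =>
      rw [lineMap_fst_of_none hlm] at hxm hym
      rwa [hxm, hym]
    | some e' =>
      rw [lineMap_fst_of_some hp hs' hlm] at hxm
      rw [lineMap_fst_of_some hp ht' hlm] at hym
      rwa [hxm, hym, e'.2.adj_iff]

variable (P H p M)

/-- The union of the copies of `P` along all combinatorial lines. -/
noncomputable def lineGraph : SimpleGraph (LineVertex P H p M) where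
  Adj u v := ∃ l x y, P.graph.Adj x y ∧ u = lineMap P H p l x ∧ v = lineMap P H p l y
  symm := ⟨by
    rintro u v ⟨l, x, y, h, hu, hv⟩
    exact ⟨l, y, x, h.symm, hv, hu⟩⟩
  loopless := ⟨by
    rintro u ⟨l, x, y, h, hu, hv⟩
    exact h.ne (lineMap_injective l (hu.symm.trans hv))⟩

/-- The partite system formed by the copies of `P` along all combinatorial lines. -/
noncomputable def lineSystem [Finite K] [Finite M] : PartiteSystem K where
  V := LineVertex P H p M
  finite := by
    have := P.finite
    infer_instance
  graph := lineGraph P H p M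
  key v := v.2.1

variable {P H p M}

theorem isEmb_lineMap [Finite K] [Finite M] (hp : Function.Injective p)
    (l : Line {e : Fin a → P.V // P.IsCopyOver H p e} M) :
    IsEmb P (lineSystem P H p M) (lineMap P H p l) where
  injective := lineMap_injective l
  adj_iff x y := by
    constructor
    · rintro ⟨l', x', y', h, hx, hy⟩
      exact adj_of_lineMap_eq hp hx hy h
    · intro h
      exact ⟨l, x, y, h, rfl, rfl⟩
  key_eq _ := rfl

end Lines

/-- The partite lemma: for a fixed choice of parts, the coloring of transversal copies of `H` can
be made constant on a copy of `P`. -/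
theorem exists_mono_copy [Finite K] (P : PartiteSystem K) (H : SimpleGraph (Fin a))
    {p : Fin a → K} (hp : Function.Injective p) {L : Type} (r : K → L) (hr : P.IsProper r)
    (k : ℕ) : ∃ Q : PartiteSystem K, Q.IsProper r ∧ ∀ χ : (Fin a → Q.V) → Fin k,
      ∃ f, IsEmb P Q f ∧ ∃ c, ∀ e, P.IsCopyOver H p e → χ (f ∘ e) = c := by
  have := P.finite
  obtain ⟨M, _, hM⟩ := Combinatorics.Line.exists_mono_in_high_dimension
    {e : Fin a → P.V // P.IsCopyOver H p e} (Fin k)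
  refine ⟨lineSystem P H p M, ?_, fun χ => ?_⟩
  · rintro u v ⟨l, x, y, h, rfl, rfl⟩
    exact hr x y h
  · obtain ⟨l, c, hc⟩ := hM fun w => χ fun t => (fun m => (w m).1 t, p t, none)
    refine ⟨lineMap P H p l, isEmb_lineMap hp l, c, fun e he => ?_⟩
    rw [← hc ⟨e, he⟩]
    congr 1
    funext t
    refine Prod.ext (funext fun m => ?_) (Prod.ext (he.key_eq t) (if_pos ⟨t, (he.key_eq t).symm⟩))
    cases hm : l.idxFun m with
    | none => exact (lineMap_fst_of_none hm).trans (by simp [hm])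
    | some e' => exact (lineMap_fst_of_some hp (he.key_eq t) hm).trans (by simp [hm])

theorem exists_mono_copy_list [Finite K] (P : PartiteSystem K) {L : Type} (r : K → L)
    (hr : P.IsProper r) (k : ℕ) (ds : List (SimpleGraph (Fin a) × (Fin a → K))) :
    ∃ Q : PartiteSystem K, Q.IsProper r ∧ ∀ χ : (Fin a → Q.V) → Fin k,
      ∃ f, IsEmb P Q f ∧ ∀ d ∈ ds, Function.Injective d.2 →
        ∃ c, ∀ e, P.IsCopyOver d.1 d.2 e → χ (f ∘ e) = c := by
  induction ds with
  | nil => exact ⟨P, hr, fun _ => ⟨id, IsEmb.refl P, by simp⟩⟩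
  | cons d ds ih =>
    obtain ⟨Q, hQ, h⟩ := ih
    by_cases hd : Function.Injective d.2
    · obtain ⟨R, hR, h'⟩ := exists_mono_copy Q d.1 hd r hQ k
      refine ⟨R, hR, fun χ => ?_⟩
      obtain ⟨g, hg, c, hc⟩ := h' χ
      obtain ⟨f, hf, hf'⟩ := h fun e => χ (g ∘ e)
      refine ⟨g ∘ f, hg.comp hf, List.forall_mem_cons.2 ⟨fun _ => ⟨c, fun e he => ?_⟩, hf'⟩⟩
      exact hc _ (hf.isCopyOver he)
    · refine ⟨Q, hQ, fun χ => ?_⟩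
      obtain ⟨f, hf, hf'⟩ := h χ
      exact ⟨f, hf, List.forall_mem_cons.2 ⟨fun h => absurd h hd, hf'⟩⟩

/-- All colorings of transversal copies can be made to depend only on the copied graph and the
parts it meets. -/
theorem exists_canonical_copy [Finite K] (P : PartiteSystem K) {L : Type} (r : K → L)
    (hr : P.IsProper r) (a k : ℕ) :
    ∃ Q : PartiteSystem K, Q.IsProper r ∧ ∀ χ : (Fin a → Q.V) → Fin k,
      ∃ f, IsEmb P Q f ∧ ∀ (H : SimpleGraph (Fin a)) (p : Fin a → K), Function.Injective p →
        ∃ c, ∀ e, P.IsCopyOver H p e → χ (f ∘ e) = c := by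
  have := Fintype.ofFinite (SimpleGraph (Fin a) × (Fin a → K))
  obtain ⟨Q, hQ, h⟩ := exists_mono_copy_list P r hr k
    (Finset.univ : Finset (SimpleGraph (Fin a) × (Fin a → K))).toList
  refine ⟨Q, hQ, fun χ => ?_⟩
  obtain ⟨f, hf, hf'⟩ := h χ
  exact ⟨f, hf, fun H p => hf' (H, p) (by simp)⟩

end PartiteSystem

/-- Finite Ramsey theorem for colorings of the `a`-element subsets. -/
theorem exists_homogeneous_finset (κ : Type) [Finite κ] (a b : ℕ) :
    ∃ N : ℕ, ∀ (α : Type) [LinearOrder α] (S₀ : Finset α), N ≤ S₀.card → ∀ χ : Finset α → κ,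
      ∃ S ⊆ S₀, S.card = b ∧ ∃ c, ∀ T ⊆ S, T.card = a → χ T = c := by
  induction a generalizing b with
  | zero =>
    refine ⟨b, fun α _ S₀ h χ => ?_⟩
    obtain ⟨S, hS, hb⟩ := Finset.exists_subset_card_eq h
    refine ⟨S, hS, hb, χ ∅, fun T _ hT => ?_⟩
    rw [Finset.card_eq_zero.1 hT]
  | succ a ih =>
    have pre : ∀ m : ℕ, ∃ N : ℕ, ∀ (α : Type) [LinearOrder α] (S₀ : Finset α), N ≤ S₀.card →
        ∀ χ : Finset α → κ, ∃ S ⊆ S₀, S.card = m ∧ ∃ φ : α → κ, ∀ T ⊆ S, T.card = a + 1 →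
          ∀ x ∈ T, (∀ y ∈ T, x ≤ y) → χ T = φ x := by
      intro m
      induction m with
      | zero =>
        refine ⟨0, fun α _ S₀ _ χ => ⟨∅, by simp, rfl, fun _ => χ ∅, fun T hT hc => ?_⟩⟩
        simp [Finset.subset_empty.1 hT] at hc
      | succ m ihm =>
        obtain ⟨N₁, h₁⟩ := ihm
        obtain ⟨N₂, h₂⟩ := ih N₁
        refine ⟨N₂ + 1, fun α _ S₀ hS₀ χ => ?_⟩
        have hne : S₀.Nonempty := Finset.card_pos.1 (by omega)
        set x := S₀.min' hne with hx
        have hxS : x ∈ S₀ := S₀.min'_mem hne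
        obtain ⟨S₁, hS₁, hc₁, c, hc⟩ := h₂ α (S₀.erase x)
          (by rw [Finset.card_erase_of_mem hxS]; omega) (fun T => χ (insert x T))
        obtain ⟨S₂, hS₂, hc₂, φ, hφ⟩ := h₁ α S₁ hc₁.ge χ
        have hS₂e := hS₂.trans hS₁
        have hx₂ : x ∉ S₂ := fun h => Finset.notMem_erase x S₀ (hS₂e h)
        refine ⟨insert x S₂, Finset.insert_subset hxS (hS₂e.trans (Finset.erase_subset _ _)),
          by rw [Finset.card_insert_of_notMem hx₂, hc₂], Function.update φ x c,
          fun T hT hTc y hy hmin => ?_⟩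
        by_cases hxT : x ∈ T
        · have hyx : y = x := by
            refine le_antisymm (hmin x hxT) (S₀.min'_le _ ?_)
            rcases Finset.mem_insert.1 (hT hy) with h | h
            · rwa [h]
            · exact Finset.mem_of_mem_erase (hS₂e h)
          rw [hyx, Function.update_self, ← Finset.insert_erase hxT]
          refine hc _ (fun z hz => hS₂ ?_) ?_
          · exact (Finset.mem_insert.1 (hT (Finset.mem_of_mem_erase hz))).resolve_left
              (Finset.ne_of_mem_erase hz)
          · rw [Finset.card_erase_of_mem hxT]; omega
        · have hTS : T ⊆ S₂ := (Finset.subset_insert_iff_of_notMem hxT).1 hT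
          rw [Function.update_of_ne (by rintro rfl; exact hxT hy)]
          exact hφ T hTS hTc y hy hmin
    have := Fintype.ofFinite κ
    classical
    obtain ⟨N, hN⟩ := pre (Fintype.card κ * b)
    refine ⟨N, fun α _ S₀ hS₀ χ => ?_⟩
    obtain ⟨S, hS, hSc, φ, hφ⟩ := hN α S₀ hS₀ χ
    obtain ⟨c, -, hc⟩ := Finset.exists_le_card_fiber_of_mul_le_card_of_maps_to
      (s := S) (t := Finset.univ) (f := φ) (n := b) (fun _ _ => Finset.mem_univ _)
      ⟨χ ∅, Finset.mem_univ _⟩ (by rw [hSc, Finset.card_univ])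
    obtain ⟨S', hS', hb⟩ := Finset.exists_subset_card_eq hc
    refine ⟨S', (hS'.trans (Finset.filter_subset _ _)).trans hS, hb, c, fun T hT hTc => ?_⟩
    have hne : T.Nonempty := Finset.card_pos.1 (by omega)
    rw [hφ T (hT.trans (hS'.trans (Finset.filter_subset _ _))) hTc _ (T.min'_mem hne)
      fun y hy => T.min'_le y hy]
    exact (Finset.mem_filter.1 (hS' (hT (T.min'_mem hne)))).2

/-- Finite Ramsey theorem for colorings of strictly increasing maps. -/
theorem exists_homogeneous_strictMono (κ : Type) [Finite κ] [Nonempty κ] (a b : ℕ) :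
    ∃ N : ℕ, ∀ χ : (Fin a → Fin N) → κ, ∃ h : Fin b → Fin N, StrictMono h ∧
      ∃ c, ∀ g : Fin a → Fin b, StrictMono g → χ (h ∘ g) = c := by
  obtain ⟨N, hN⟩ := exists_homogeneous_finset κ a b
  refine ⟨N, fun χ => ?_⟩
  classical
  obtain ⟨S, -, hS, c, hc⟩ := hN (Fin N) Finset.univ (by simp) fun T =>
    if h : T.card = a then χ (T.orderEmbOfFin h) else Classical.arbitrary κ
  refine ⟨S.orderEmbOfFin hS, (S.orderEmbOfFin hS).strictMono, c, fun g hg => ?_⟩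
  have hmono := (S.orderEmbOfFin hS).strictMono.comp hg
  have hcard : (Finset.univ.image (S.orderEmbOfFin hS ∘ g)).card = a := by
    rw [Finset.card_image_of_injective _ hmono.injective, Finset.card_fin]
  rw [← hc (Finset.univ.image (S.orderEmbOfFin hS ∘ g)) ?_ hcard, dif_pos hcard]
  · exact congrArg χ (Finset.orderEmbOfFin_unique hcard
      (fun i => Finset.mem_image_of_mem _ (Finset.mem_univ i)) hmono)
  · intro x hx
    obtain ⟨i, -, rfl⟩ := Finset.mem_image.1 hx
    exact Finset.orderEmbOfFin_mem S hS _

/-- The disjoint union of copies of the labelled graph `Y`, one for each map from its vertices to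
`Fin N`, the vertex `i` of the copy at `J` lying in the part `(J i, lam i)`. -/
def PartiteSystem.unionOfCopies {b n : ℕ} (Y : SimpleGraph (Fin b)) (lam : Fin b → Fin n) (N : ℕ) :
    PartiteSystem (Fin N × Fin n) where
  V := (Fin b → Fin N) × Fin b
  finite := inferInstance
  graph :=
    { Adj := fun u v => u.1 = v.1 ∧ Y.Adj u.2 v.2
      symm := ⟨fun _ _ h => ⟨h.1.symm, h.2.symm⟩⟩
      loopless := ⟨fun _ h => h.2.ne rfl⟩ }
  key u := (u.1 u.2, lam u.2)

/-- A colorable graph can be reordered so that it has a monotone proper coloring. -/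
theorem exists_monotone_properCol {n b : ℕ} {Y : SimpleGraph (Fin b)} (hY : Y.Colorable n) :
    ∃ (σ : Equiv.Perm (Fin b)) (lam : Fin b → Fin n),
      ProperCol (Y.comap σ) lam ∧ Monotone lam := by
  obtain ⟨C⟩ := hY
  exact ⟨Tuple.sort C, C ∘ Tuple.sort C, fun i j h => C.valid h, Tuple.monotone_sort C⟩

/-- upper bound: for every `Y ∈ C_n` and `k` there is `Z ∈ C_n` such
that every `k`-coloring of the copies of `X` in `Z` takes at most `τ(X)` values on
the copies of `X` in some copy of `Y`. -/
theorem stmt_12 (n : ℕ) (hn : 1 ≤ n) (a : ℕ)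
    (X : SimpleGraph (Fin a)) (hX : X.Colorable n) :
    ∀ (b : ℕ) (Y : SimpleGraph (Fin b)), Y.Colorable n →
      ∀ k : ℕ, ∃ (c : ℕ) (Z : SimpleGraph (Fin c)), Z.Colorable n ∧
        ∀ α : Finset (Fin c) → Fin k,
          ∃ T : Finset (Fin c), IsCopy Y Z T ∧
            ∃ V : Finset (Fin k), V.card ≤ TauNum n X ∧
              ∀ S : Finset (Fin c), S ⊆ T → IsCopy X Z S → α S ∈ V := by
  intro b Y hY k
  obtain rfl | hk := Nat.eq_zero_or_pos k
  · exact ⟨0, ⊥, ⟨⟨finZeroElim, fun {i} => i.elim0⟩⟩, fun α => (α ∅).elim0⟩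
  have : Nonempty (Fin k) := ⟨⟨0, hk⟩⟩
  classical
  obtain ⟨σ, lam, hlam, hmono⟩ := exists_monotone_properCol hY
  obtain ⟨N, hN⟩ := exists_homogeneous_strictMono
    (SimpleGraph (Fin a) × (Fin a → Fin n) → Fin k) a b
  set P := PartiteSystem.unionOfCopies (Y.comap σ) lam N
  obtain ⟨Q, hQ, hQχ⟩ := P.exists_canonical_copy Prod.snd (fun x y h => hlam _ _ h.2) a k
  have := Q.finite
  obtain ⟨c, ⟨ε⟩⟩ := Finite.exists_equiv_fin Q.V
  refine ⟨c, Q.graph.comap ε.symm, ⟨⟨fun i => (Q.key (ε.symm i)).2, fun h => hQ _ _ h⟩⟩,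
    fun α => ?_⟩
  obtain ⟨f, hf, hcol⟩ := hQχ fun e => α (Finset.univ.image (ε ∘ e))
  choose! col hcol using hcol
  obtain ⟨h, hh, F, hF⟩ := hN fun I p => col p.1 fun t => (I t, p.2 t)
  have hinj : Function.Injective fun i : Fin b => ε (f (h, i)) := fun i j hij =>
    congrArg Prod.snd (hf.injective (ε.injective hij))
  have hadj : ∀ i j, (Q.graph.comap ε.symm).Adj (ε (f (h, i))) (ε (f (h, j))) ↔
      Y.Adj (σ i) (σ j) := fun i j => by
    simp only [SimpleGraph.comap_adj, Equiv.symm_apply_apply]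
    exact (hf.adj_iff _ _).trans ⟨fun H => H.2, fun H => ⟨rfl, H⟩⟩
  refine ⟨Finset.univ.image fun i => ε (f (h, i)),
    ⟨fun i => ε (f (h, σ.symm i)), hinj.comp σ.symm.injective, fun i j => (hadj _ _).trans (by simp), ?_⟩,
    Finset.univ.image fun p : {p : SimpleGraph (Fin a) × (Fin a → Fin n) //
      Nonempty (p.1 ≃g X) ∧ ProperCol p.1 p.2 ∧ Monotone p.2} => F p.1, ?_, ?_⟩
  · ext v
    simp only [Finset.mem_image, Finset.mem_univ, true_and]
    exact (σ.symm.surjective.exists (p := fun i => ε (f (h, i)) = v)).symm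
  · rw [TauNum, Nat.card_eq_fintype_card]
    exact Finset.card_image_le
  · rintro S hST ⟨φ, hφ, hφadj, rfl⟩
    have hψ : ∀ t, ∃ i, ε (f (h, i)) = φ t := fun t => by
      simpa using hST (Finset.mem_image_of_mem φ (Finset.mem_univ t))
    choose ψ hψ using hψ
    have hψinj : Function.Injective ψ := fun s t hst => hφ (by rw [← hψ, ← hψ, hst])
    set ρ := Tuple.sort ψ
    have hg : StrictMono (ψ ∘ ρ) :=
      (Tuple.monotone_sort ψ).strictMono_of_injective (hψinj.comp ρ.injective)
    have hHX : ∀ s t, (Y.comap σ).Adj (ψ s) (ψ t) ↔ X.Adj s t := fun s t => by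
      rw [← hφadj, ← hψ, ← hψ, hadj]
      rfl
    refine Finset.mem_image.2 ⟨⟨((Y.comap σ).comap (ψ ∘ ρ), lam ∘ ψ ∘ ρ),
      ⟨⟨ρ, fun {s t} => (hHX _ _).symm⟩⟩, fun s t H => hlam _ _ H, hmono.comp hg.monotone⟩,
      Finset.mem_univ _, ?_⟩
    have he : P.IsCopyOver ((Y.comap σ).comap (ψ ∘ ρ)) (fun t => (h (ψ (ρ t)), lam (ψ (ρ t))))
        fun t => (h, ψ (ρ t)) :=
      ⟨fun s t => ⟨fun H => H.2, fun H => ⟨rfl, H⟩⟩, fun t => rfl⟩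
    rw [← hF _ hg]
    refine (hcol _ _ (fun s t hst => ?_) _ he).symm.trans ?_
    · exact (hh.comp hg).injective (congrArg Prod.fst hst)
    congr 1
    ext v
    simp only [Finset.mem_image, Finset.mem_univ, true_and]
    change (∃ t, ε (f (h, ψ (ρ t))) = v) ↔ _
    simp only [hψ]
    exact (ρ.surjective.exists (p := fun t => φ t = v)).symm
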